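/- Let Ω ⊆ ℝ^d be open and connected, let F satisfy conditions (i) and (ii), and assume F has locally Lipschitz subunit vector fields Z₁,…,Z_m : closure(Ω) → ℝ^d. Let u ∈ USC(Ω) be a viscosity subsolution of F(x,u,Du,D²u) = 0 achieving a nonnegative maximum at x ∈ Ω. Then Prop(x,u) contains all points reachable from x by the control system (S): if y = y_x(t,β) for some t > 0 and some admissible control β, then y ∈ Prop(x,u). -/

import Mathlib

open Set Metric Filter Topology

noncomputable section

/-- Euclidean space `ℝ^d`. -/
abbrev EV (d : ℕ) := EuclideanSpace ℝ (Fin d)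

/-- The outer product `p ⊗ p` as a `d × d` matrix. -/
def outer {d : ℕ} (p : EV d) : Matrix (Fin d) (Fin d) ℝ := Matrix.of fun i j => p i * p j

/-- Euclidean dot product. -/
def dotp {d : ℕ} (p q : EV d) : ℝ := ∑ i, p i * q i

/-- Euclidean gradient. -/
def grad {d : ℕ} (φ : EV d → ℝ) (x : EV d) : EV d :=
  (EuclideanSpace.equiv (Fin d) ℝ).symm fun i => fderiv ℝ φ x (EuclideanSpace.single i 1)

/-- Euclidean Hessian matrix. -/
def hess {d : ℕ} (φ : EV d → ℝ) (x : EV d) : Matrix (Fin d) (Fin d) ℝ :=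
  Matrix.of fun i j =>
    fderiv ℝ (fun y => fderiv ℝ φ y (EuclideanSpace.single j 1)) x (EuclideanSpace.single i 1)

/-- `F` is proper: nondecreasing in `r`, nonincreasing in the matrix argument
(w.r.t. the positive semidefinite order `Y ≤ X ↔ (X - Y).PosSemidef`). -/
def IsProper {d m : ℕ} (Ω : Set (EV d))
    (F : EV d → ℝ → EV m → Matrix (Fin m) (Fin m) ℝ → ℝ) : Prop :=
  ∀ x ∈ Ω, ∀ r s : ℝ, ∀ p : EV m, ∀ X Y : Matrix (Fin m) (Fin m) ℝ,
    r ≤ s → (X - Y).PosSemidef → F x r p X ≤ F x s p Y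

/-- Lower semicontinuity of the operator `F`, jointly in all its arguments. -/
def IsLscOperator {d m : ℕ} (Ω : Set (EV d))
    (F : EV d → ℝ → EV m → Matrix (Fin m) (Fin m) ℝ → ℝ) : Prop :=
  LowerSemicontinuousOn
    (fun q : EV d × ℝ × EV m × Matrix (Fin m) (Fin m) ℝ => F q.1 q.2.1 q.2.2.1 q.2.2.2)
    {q | q.1 ∈ Ω ∧ q.2.2.1 ≠ 0 ∧ q.2.2.2.IsSymm}

/-- Condition (ii) (scaling): for some `φ : (0,1] → (0,∞)`,
`F(x, ξs, ξp, ξX) ≥ φ(ξ) F(x,s,p,X)` for all `ξ ∈ (0,1]`, `s ∈ [-1,0]`. -/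
def HasScaling {d m : ℕ} (Ω : Set (EV d))
    (F : EV d → ℝ → EV m → Matrix (Fin m) (Fin m) ℝ → ℝ) : Prop :=
  ∃ φ : ℝ → ℝ, (∀ ξ ∈ Ioc (0:ℝ) 1, 0 < φ ξ) ∧
    ∀ ξ ∈ Ioc (0:ℝ) 1, ∀ s ∈ Icc (-1:ℝ) 0, ∀ x ∈ Ω, ∀ p : EV m, p ≠ 0 →
      ∀ X : Matrix (Fin m) (Fin m) ℝ, X.IsSymm →
        φ ξ * F x s p X ≤ F x (ξ * s) (ξ • p) (ξ • X)

/-- Ellipticity condition (elli) for a subelliptic operator `G`. -/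
def IsElliptic {d m : ℕ} (Ω : Set (EV d))
    (G : EV d → ℝ → EV m → Matrix (Fin m) (Fin m) ℝ → ℝ) : Prop :=
  ∀ x ∈ Ω, ∀ q : EV m, q ≠ 0 → ∀ X : Matrix (Fin m) (Fin m) ℝ, X.IsSymm →
    ∃ γ : ℝ, 0 < γ ∧ 0 < G x 0 q (X - γ • outer q)

/-- `Z` is a generalized subunit vector for `F` at `x`:
`sup_{γ>0} F(x,0,p, I - γ p⊗p) > 0` whenever `Z·p ≠ 0`. -/
def IsSubunitAt {d : ℕ} (F : EV d → ℝ → EV d → Matrix (Fin d) (Fin d) ℝ → ℝ)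
    (x : EV d) (Z : EV d) : Prop :=
  ∀ p : EV d, dotp Z p ≠ 0 → ∃ γ : ℝ, 0 < γ ∧ 0 < F x 0 p (1 - γ • outer p)

/-- Viscosity subsolution (test functions with nonvanishing gradient). -/
def IsViscSubsol {d : ℕ} (Ω : Set (EV d))
    (F : EV d → ℝ → EV d → Matrix (Fin d) (Fin d) ℝ → ℝ) (u : EV d → ℝ) : Prop :=
  ∀ φ : EV d → ℝ, ContDiff ℝ 2 φ → ∀ x ∈ Ω,
    IsLocalMaxOn (fun y => u y - φ y) Ω x → grad φ x ≠ 0 →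
      F x (u x) (grad φ x) (hess φ x) ≤ 0

/-- Viscosity supersolution (test functions with nonvanishing gradient). -/
def IsViscSupersol {d : ℕ} (Ω : Set (EV d))
    (F : EV d → ℝ → EV d → Matrix (Fin d) (Fin d) ℝ → ℝ) (v : EV d → ℝ) : Prop :=
  ∀ φ : EV d → ℝ, ContDiff ℝ 2 φ → ∀ x ∈ Ω,
    IsLocalMinOn (fun y => v y - φ y) Ω x → grad φ x ≠ 0 →
      0 ≤ F x (v x) (grad φ x) (hess φ x)

/-- Viscosity subsolution (all `C²` test functions). -/
def IsViscSubsolAll {d : ℕ} (Ω : Set (EV d))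
    (F : EV d → ℝ → EV d → Matrix (Fin d) (Fin d) ℝ → ℝ) (u : EV d → ℝ) : Prop :=
  ∀ φ : EV d → ℝ, ContDiff ℝ 2 φ → ∀ x ∈ Ω,
    IsLocalMaxOn (fun y => u y - φ y) Ω x →
      F x (u x) (grad φ x) (hess φ x) ≤ 0

/-- Viscosity supersolution (all `C²` test functions). -/
def IsViscSupersolAll {d : ℕ} (Ω : Set (EV d))
    (F : EV d → ℝ → EV d → Matrix (Fin d) (Fin d) ℝ → ℝ) (v : EV d → ℝ) : Prop :=
  ∀ φ : EV d → ℝ, ContDiff ℝ 2 φ → ∀ x ∈ Ω,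
    IsLocalMinOn (fun y => v y - φ y) Ω x →
      0 ≤ F x (v x) (grad φ x) (hess φ x)

/-- Locally Lipschitz on a set. -/
def LocLipschitzOn {α β : Type*} [PseudoMetricSpace α] [PseudoMetricSpace β]
    (f : α → β) (s : Set α) : Prop :=
  ∀ x ∈ s, ∃ K : NNReal, ∃ ε : ℝ, 0 < ε ∧ LipschitzOnWith K f (s ∩ Metric.ball x ε)

/-- Admissible controls: measurable, with `∑ i βᵢ(t)² ≤ 1`. -/
def Admissible {m : ℕ} (β : ℝ → Fin m → ℝ) : Prop :=
  (∀ i, Measurable fun t => β t i) ∧ ∀ t : ℝ, ∑ i, (β t i) ^ 2 ≤ 1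

/-- (Carathéodory) trajectory of the control system `y' = ∑ᵢ βᵢ Zᵢ(y)` on `[0, T]`. -/
def IsTrajOn {d m : ℕ} (Z : Fin m → EV d → EV d) (β : ℝ → Fin m → ℝ)
    (y : ℝ → EV d) (T : ℝ) : Prop :=
  ContinuousOn y (Icc 0 T) ∧
    ∀ t ∈ Icc 0 T, y t = y 0 + ∫ s in (0:ℝ)..t, ∑ i, β s i • Z i (y s)

/-- `x₁` is reachable from `x₀` by the control system, with trajectory staying in `Ω`. -/
def ReachableIn {d m : ℕ} (Ω : Set (EV d)) (Z : Fin m → EV d → EV d)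
    (x₀ x₁ : EV d) : Prop :=
  ∃ (β : ℝ → Fin m → ℝ) (y : ℝ → EV d) (T : ℝ), 0 ≤ T ∧ Admissible β ∧
    IsTrajOn Z β y T ∧ (∀ t ∈ Icc 0 T, y t ∈ Ω) ∧ y 0 = x₀ ∧ y T = x₁

/-- Bounded time controllability in `Ω`. -/
def BTC {d m : ℕ} (Ω : Set (EV d)) (Z : Fin m → EV d → EV d) : Prop :=
  ∀ x₀ ∈ Ω, ∀ x₁ ∈ Ω, ReachableIn Ω Z x₀ x₁

/-- Generalized exterior (Bony, proximal) normal `ν` to `K` at `z`. -/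
def IsExtNormal {d : ℕ} (K : Set (EV d)) (z ν : EV d) : Prop :=
  z ∈ frontier K ∧ ‖ν‖ = 1 ∧
    ∃ t : ℝ, 0 < t ∧ Metric.closedBall (z + t • ν) t ∩ closure K = {z}

/-- Lie bracket of two vector fields. -/
def vfBracket {d : ℕ} (X Y : EV d → EV d) : EV d → EV d :=
  fun x => fderiv ℝ Y x (X x) - fderiv ℝ X x (Y x)

/-- Vector fields obtained from `Z₁,…,Z_m` by iterated Lie brackets. -/
inductive LieGenerated {d m : ℕ} (Z : Fin m → EV d → EV d) : (EV d → EV d) → Prop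
  | base (i : Fin m) : LieGenerated Z (Z i)
  | bracket {X Y : EV d → EV d} :
      LieGenerated Z X → LieGenerated Z Y → LieGenerated Z (vfBracket X Y)

/-- Hörmander condition: the fields and their iterated brackets span `ℝ^d` at every point of `Ω`. -/
def Hormander {d m : ℕ} (Ω : Set (EV d)) (Z : Fin m → EV d → EV d) : Prop :=
  ∀ x ∈ Ω, Submodule.span ℝ {v : EV d | ∃ W, LieGenerated Z W ∧ W x = v} = ⊤

/-- Intrinsic (horizontal) gradient `σ(x)ᵀ p`. -/
def sigmaT {d m : ℕ} (σ : Fin m → EV d → EV d) (x : EV d) (p : EV d) : EV m :=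
  (EuclideanSpace.equiv (Fin m) ℝ).symm fun j => ∑ i, σ j x i * p i

/-- `σ(x)ᵀ X σ(x)` as an `m × m` matrix. -/
def sigmaHess {d m : ℕ} (σ : Fin m → EV d → EV d) (x : EV d)
    (X : Matrix (Fin d) (Fin d) ℝ) : Matrix (Fin m) (Fin m) ℝ :=
  Matrix.of fun j k => ∑ i, ∑ l, σ j x i * X i l * σ k x l

/-- First-order correction term `g(x,p)` of the symmetrized intrinsic Hessian. -/
def corrTerm {d m : ℕ} (σ : Fin m → EV d → EV d) (x : EV d) (p : EV d) :
    Matrix (Fin m) (Fin m) ℝ :=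
  Matrix.of fun j k =>
    ((∑ i, (fderiv ℝ (σ k) x (σ j x)) i * p i) +
      (∑ i, (fderiv ℝ (σ j) x (σ k x)) i * p i)) / 2

/-- Euclidean form `F(x,r,p,X) = G(x, r, σᵀp, σᵀXσ + g(x,p))` of a subelliptic operator. -/
def euclOp {d m : ℕ} (σ : Fin m → EV d → EV d)
    (G : EV d → ℝ → EV m → Matrix (Fin m) (Fin m) ℝ → ℝ) :
    EV d → ℝ → EV d → Matrix (Fin d) (Fin d) ℝ → ℝ :=
  fun x r p X => G x r (sigmaT σ x p) (sigmaHess σ x X + corrTerm σ x p)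

/-- `A ≥ Z ⊗ Z` in the quadratic-form sense: `ξᵀAξ ≥ (Z·ξ)²` for all `ξ`. -/
def matGEouter {d : ℕ} (A : Matrix (Fin d) (Fin d) ℝ) (Z : EV d) : Prop :=
  ∀ ξ : EV d, (dotp Z ξ) ^ 2 ≤ ∑ i, ∑ j, A i j * ξ i * ξ j

/-- The quadratic polynomial vanishing at `z` with gradient `p` at `z` and constant Hessian
`I - γ p ⊗ p`. -/
def quadTest {d : ℕ} (z p : EV d) (γ : ℝ) (x : EV d) : ℝ :=
  inner ℝ p (x - z) + ‖x - z‖ ^ 2 / 2 - γ / 2 * inner ℝ p (x - z) ^ 2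

/-- The gradient of `quadTest z p γ`. -/
def quadTestGrad {d : ℕ} (z p : EV d) (γ : ℝ) (x : EV d) : EV d :=
  p + (x - z) - (γ * inner ℝ p (x - z)) • p

lemma hasFDerivAt_clm_sub {E G : Type*} [NormedAddCommGroup E] [NormedSpace ℝ E]
    [NormedAddCommGroup G] [NormedSpace ℝ G] (L : E →L[ℝ] G) (z x : E) :
    HasFDerivAt (fun y => L (y - z)) L x := by
  simpa only [map_sub] using L.hasFDerivAt.sub_const (L z)

section QuadTest

variable {d : ℕ} (z p : EV d) (γ ε : ℝ)

lemma contDiff_quadTest : ContDiff ℝ 2 (quadTest z p γ) := by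
  have h : ContDiff ℝ 2 fun x : EV d => x - z := contDiff_id.sub contDiff_const
  have h' : ContDiff ℝ 2 fun x : EV d => inner ℝ p (x - z) := contDiff_const.inner ℝ h
  exact (h'.add ((h.norm_sq ℝ).div_const 2)).sub (contDiff_const.mul (h'.pow 2))

lemma continuous_quadTest : Continuous (quadTest z p γ) :=
  (contDiff_quadTest z p γ).continuous

lemma continuous_quadTestGrad : Continuous (quadTestGrad z p γ) := by
  unfold quadTestGrad
  fun_prop

@[simp] lemma quadTest_self : quadTest z p γ z = 0 := by simp [quadTest]

@[simp] lemma quadTestGrad_self : quadTestGrad z p γ z = p := by simp [quadTestGrad]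

lemma hasFDerivAt_quadTest (x : EV d) :
    HasFDerivAt (quadTest z p γ) (innerSL ℝ (quadTestGrad z p γ x)) x := by
  have h1 : HasFDerivAt (fun x : EV d => x - z) (ContinuousLinearMap.id ℝ (EV d)) x :=
    (hasFDerivAt_id x).sub_const z
  have h2 : HasFDerivAt (fun x : EV d => inner ℝ p (x - z)) (innerSL ℝ p) x :=
    hasFDerivAt_clm_sub (innerSL ℝ p) z x
  have h := (h2.add (h1.norm_sq.const_mul (1 / 2))).sub ((h2.pow 2).const_mul (γ / 2))
  refine (h.congr_fderiv ?_).congr_of_eventuallyEq (.of_forall fun y => ?_)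
  · ext v
    simp [quadTestGrad]
    ring
  · simp [quadTest]
    ring

lemma grad_quadTest (x : EV d) :
    grad (fun y => ε * quadTest z p γ y) x = ε • quadTestGrad z p γ x := by
  ext i
  simp [grad, ((hasFDerivAt_quadTest z p γ x).const_mul ε).fderiv,
    EuclideanSpace.inner_single_right]

lemma hess_quadTest (x : EV d) :
    hess (fun y => ε * quadTest z p γ y) x = ε • (1 - γ • outer p) := by
  ext i j
  have h2 : HasFDerivAt (fun x : EV d => inner ℝ p (x - z)) (innerSL ℝ p) x :=
    hasFDerivAt_clm_sub (innerSL ℝ p) z x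
  have h3 : HasFDerivAt (fun x : EV d => (x - z) j) (EuclideanSpace.proj j : EV d →L[ℝ] ℝ) x :=
    hasFDerivAt_clm_sub (EuclideanSpace.proj j : EV d →L[ℝ] ℝ) z x
  have h : HasFDerivAt (fun y => ε * (p j + (y - z) j - γ * inner ℝ p (y - z) * p j)) _ x :=
    ((h3.const_add (p j)).sub ((h2.const_mul γ).mul_const (p j))).const_mul ε
  have key : (fun y => fderiv ℝ (fun y => ε * quadTest z p γ y) y (EuclideanSpace.single j 1))
      = fun y => ε * (p j + (y - z) j - γ * inner ℝ p (y - z) * p j) := by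
    funext y
    simp [((hasFDerivAt_quadTest z p γ y).const_mul ε).fderiv,
      EuclideanSpace.inner_single_right, quadTestGrad]
  simp only [hess, Matrix.of_apply, key, h.fderiv]
  simp [outer, EuclideanSpace.inner_single_right, Matrix.one_apply, eq_comm]
  left; ring

end QuadTest

lemma isSymm_one_sub_smul_outer {d : ℕ} (p : EV d) (γ : ℝ) :
    (1 - γ • outer p : Matrix (Fin d) (Fin d) ℝ).IsSymm := by
  ext i j
  simp [outer, Matrix.one_apply, mul_comm, eq_comm]

lemma dotp_eq_inner {d : ℕ} (p q : EV d) : dotp p q = inner ℝ p q := by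
  simp [dotp, PiLp.inner_apply, mul_comm]

/-- Near `z`, the function `quadTest z p γ` is positive on any set (other than at `z`) for which
`-2 p` is a proximal normal vector at `z`. -/
lemma eventually_quadTest_pos {d : ℕ} (z p : EV d) (γ : ℝ) :
    ∀ᶠ x in 𝓝 z, -4 * inner ℝ p (x - z) ≤ ‖x - z‖ ^ 2 → x ≠ z → 0 < quadTest z p γ x := by
  have hc : Continuous fun x : EV d => γ * inner ℝ p (x - z) := by fun_prop
  have h1 : ∀ᶠ x in 𝓝 z, |γ * inner ℝ p (x - z)| < 1 :=
    hc.abs.continuousAt.eventually_lt continuousAt_const (by simp)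
  filter_upwards [h1] with x hx hle hne
  have hpos : 0 < ‖x - z‖ ^ 2 := by
    have := norm_pos_iff.2 (sub_ne_zero.2 hne)
    positivity
  obtain ⟨ha, hb⟩ := abs_lt.1 hx
  unfold quadTest
  set a : ℝ := inner ℝ p (x - z)
  rcases le_total 0 a with h | h <;> nlinarith

/-- Hopf-type lemma: the subunit vector at a point where a subsolution attains a nonnegative
maximum is orthogonal to every proximal normal to the set of maximum points. -/
lemma inner_eq_zero_of_proximal_normal {d : ℕ} {Ω : Set (EV d)} (hΩ : IsOpen Ω)
    {F : EV d → ℝ → EV d → Matrix (Fin d) (Fin d) ℝ → ℝ}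
    (hFlsc : IsLscOperator Ω F) (hFprop : IsProper Ω F) (hFscal : HasScaling Ω F)
    {u : EV d → ℝ} (husc : UpperSemicontinuousOn u Ω) (hsub : IsViscSubsol Ω F u)
    {M : ℝ} (hM : 0 ≤ M) (hmax : ∀ x ∈ Ω, u x ≤ M)
    {z n v : EV d} (hz : z ∈ Ω) (huz : u z = M) (hv : IsSubunitAt F z v)
    (hn : ∀ᶠ x in 𝓝 z, x ∈ Ω → u x = M → 2 * inner ℝ n (x - z) ≤ ‖x - z‖ ^ 2) :
    inner ℝ n v = 0 := by
  by_contra hne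
  set p : EV d := -(1 / 2 : ℝ) • n with hp
  have hpn : ∀ w : EV d, inner ℝ p w = -(1 / 2) * inner ℝ n w := fun w => by
    simp [hp, inner_smul_left]
  have hvp : dotp v p ≠ 0 := by
    rw [dotp_eq_inner, real_inner_comm, hpn]
    exact mul_ne_zero (by norm_num) hne
  obtain ⟨γ, -, hF⟩ := hv p hvp
  have hp0 : p ≠ 0 := by
    rintro h
    simp [h, dotp] at hvp
  set X : Matrix (Fin d) (Fin d) ℝ := 1 - γ • outer p
  have hX : X.IsSymm := isSymm_one_sub_smul_outer p γ
  have hw := continuous_quadTest z p γ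
  have hG := continuous_quadTestGrad z p γ
  have e1 : ∀ᶠ x in 𝓝 z, x ∈ Ω := hΩ.mem_nhds hz
  have e2 : ∀ᶠ x in 𝓝 z, quadTestGrad z p γ x ≠ 0 :=
    hG.continuousAt.eventually_ne (by simpa using hp0)
  have e3 : ∀ᶠ x in 𝓝 z, -1 < quadTest z p γ x :=
    continuousAt_const.eventually_lt hw.continuousAt (by simp)
  have e4 : ∀ᶠ x in 𝓝 z, 0 < F x (quadTest z p γ x) (quadTestGrad z p γ x) X := by
    have hl := hFlsc (z, 0, p, X) ⟨hz, hp0, hX⟩ 0 hF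
    have ht : Tendsto (fun x => (x, quadTest z p γ x, quadTestGrad z p γ x, X)) (𝓝 z)
        (𝓝[{q : EV d × ℝ × EV d × Matrix (Fin d) (Fin d) ℝ |
          q.1 ∈ Ω ∧ q.2.2.1 ≠ 0 ∧ q.2.2.2.IsSymm}] (z, 0, p, X)) := by
      refine tendsto_nhdsWithin_iff.2 ⟨?_, ?_⟩
      · have hc : Continuous fun x => (x, quadTest z p γ x, quadTestGrad z p γ x, X) := by
          fun_prop
        simpa using hc.tendsto z
      · filter_upwards [e1, e2] with x h1 h2 using ⟨h1, h2, hX⟩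
    exact ht.eventually hl
  have e5 := eventually_quadTest_pos z p γ
  obtain ⟨R, hR, hball⟩ := Metric.eventually_nhds_iff_ball.1
    (e1.and (e2.and (e3.and (e4.and (e5.and hn)))))
  set r := R / 2 with hr
  have hr0 : 0 < r := by positivity
  have hsubs : ∀ x ∈ closedBall z r, x ∈ ball z R := fun x hx => by
    rw [mem_ball]; rw [mem_closedBall] at hx; linarith
  have hB : closedBall z r ⊆ Ω := fun x hx => (hball x (hsubs x hx)).1
  obtain ⟨ε, hε0, hε1, hε⟩ : ∃ ε : ℝ, 0 < ε ∧ ε ≤ 1 ∧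
      ∀ x ∈ sphere z r, u x - ε * quadTest z p γ x < M := by
    have hpos : ∀ x ∈ sphere z r, 0 < quadTest z p γ x → ∀ ε > 0,
        u x - ε * quadTest z p γ x < M := fun x hx hwx ε hε => by
      have := hmax x (hB (sphere_subset_closedBall hx))
      have := mul_pos hε hwx
      linarith
    set A := sphere z r ∩ {x | quadTest z p γ x ≤ 0}
    have hA : IsCompact A := (isCompact_sphere z r).inter_right (isClosed_le hw continuous_const)
    have hAB : A ⊆ closedBall z r := inter_subset_left.trans sphere_subset_closedBall
    rcases A.eq_empty_or_nonempty with hAe | hAn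
    · refine ⟨1, one_pos, le_rfl, fun x hx => hpos x hx ?_ 1 one_pos⟩
      by_contra h
      exact (hAe ▸ (⟨hx, not_lt.1 h⟩ : x ∈ A) : x ∈ (∅ : Set (EV d)))
    · obtain ⟨a, ha, hamax⟩ := UpperSemicontinuousOn.exists_isMaxOn hAn hA
        (husc.mono (hAB.trans hB))
      have hlt : u a < M := by
        refine lt_of_le_of_ne (hmax a (hB (hAB ha))) fun h => ?_
        obtain ⟨h1, -, -, -, h5, h6⟩ := hball a (hsubs a (hAB ha))
        refine absurd (h5 ?_ ?_) (not_lt.2 ha.2)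
        · have := h6 h1 h
          rw [hpn]; linarith
        · rintro rfl
          have := ha.1
          simp at this
          exact hr0.ne this
      refine ⟨min 1 ((M - u a) / 2), lt_min one_pos (by linarith), min_le_left _ _, ?_⟩
      intro x hx
      have hε0 : 0 < min 1 ((M - u a) / 2) := lt_min one_pos (by linarith)
      by_cases hwx : 0 < quadTest z p γ x
      · exact hpos x hx hwx _ hε0
      · have h1 : u x ≤ u a := hamax ⟨hx, not_lt.1 hwx⟩
        have h2 := (hball x (hsubs x (sphere_subset_closedBall hx))).2.2.1
        have h3 := min_le_right 1 ((M - u a) / 2)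
        nlinarith
  obtain ⟨b, hb, hbmax⟩ := UpperSemicontinuousOn.exists_isMaxOn
    (f := fun x => u x - ε * quadTest z p γ x) ⟨z, mem_closedBall_self hr0.le⟩
    (isCompact_closedBall z r) (by
      simp only [sub_eq_add_neg]
      exact (husc.mono hB).add
        ((continuous_const.mul hw).neg.upperSemicontinuous.upperSemicontinuousOn _))
  have hbz : M ≤ u b - ε * quadTest z p γ b := by
    have := hbmax (mem_closedBall_self (x := z) hr0.le)
    simpa [huz] using this
  have hb' : b ∈ ball z r := by
    rcases (mem_closedBall.1 hb).lt_or_eq with h | h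
    · exact h
    · exact absurd (hε b h) (not_lt.2 hbz)
  obtain ⟨hbΩ, hb2, hb3, hb4, -, -⟩ := hball b (hsubs b hb)
  have hloc : IsLocalMaxOn (fun y => u y - ε * quadTest z p γ y) Ω b := by
    have : ∀ᶠ y in 𝓝 b, u y - ε * quadTest z p γ y ≤ u b - ε * quadTest z p γ b := by
      filter_upwards [isOpen_ball.mem_nhds hb'] with y hy using hbmax (ball_subset_closedBall hy)
    exact this.filter_mono nhdsWithin_le_nhds
  have hvisc := hsub (fun y => ε * quadTest z p γ y)
    (contDiff_const.mul (contDiff_quadTest z p γ)) b hbΩ hloc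
    (by rw [grad_quadTest]; exact smul_ne_zero hε0.ne' hb2)
  rw [grad_quadTest, hess_quadTest] at hvisc
  have hub := hmax b hbΩ
  obtain ⟨φ, hφ, hscal⟩ := hFscal
  have hs := hscal ε ⟨hε0, hε1⟩ (quadTest z p γ b) ⟨hb3.le, by nlinarith⟩ b hbΩ _ hb2 X hX
  have hpr := hFprop b hbΩ (ε * quadTest z p γ b) (u b) (ε • quadTestGrad z p γ b) (ε • X) (ε • X)
    (by linarith) (by simpa using Matrix.PosSemidef.zero)
  have := mul_pos (hφ ε ⟨hε0, hε1⟩) hb4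
  linarith
/-- A continuous curve starting in a closed set `K` stays in `K` if its increments satisfy, with
respect to the projections on `K`, a one-sided estimate of Gronwall type. -/
lemma mem_of_projection_estimate {E : Type*} [NormedAddCommGroup E] [InnerProductSpace ℝ E]
    {K : Set E} (hK : IsClosed K) {y : ℝ → E} {a b A C : ℝ}
    (hy : ContinuousOn y (Icc a b)) (ha : y a ∈ K)
    (hinc : ∀ s ∈ Ico a b, ∀ t ∈ Ioc s b, ‖y t - y s‖ ≤ C * (t - s))
    (hproj : ∀ s ∈ Ico a b, ∃ z ∈ K, infDist (y s) K = dist (y s) z ∧ ∀ t ∈ Ioc s b,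
      inner ℝ (y s - z) (y t - y s) ≤ A * ‖y s - z‖ * (‖y s - z‖ + C * (t - s)) * (t - s)) :
    ∀ t ∈ Icc a b, y t ∈ K := by
  have hg := le_gronwallBound_of_liminf_deriv_right_le (f := fun t => infDist (y t) K ^ 2)
    (f' := fun t => 2 * A * infDist (y t) K ^ 2) (δ := 0) (K := 2 * A) (ε := 0) (a := a) (b := b)
    (((continuous_infDist_pt K).comp_continuousOn hy).pow 2) ?_
    (by simp [infDist_zero_of_mem ha]) (fun x _ => by simp)
  · intro t ht
    have h := hg t ht
    simp only [gronwallBound_ε0_δ0] at h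
    have h0 : infDist (y t) K = 0 := by
      have := sq_nonneg (infDist (y t) K)
      exact pow_eq_zero_iff two_ne_zero |>.1 (le_antisymm h this)
    exact (hK.mem_iff_infDist_zero ⟨_, ha⟩).2 h0
  · intro s hs r hr
    obtain ⟨z, hz, hzd, hin⟩ := hproj s hs
    set N := ‖y s - z‖ with hN
    rw [dist_eq_norm] at hzd
    have hcont : ContinuousAt (fun t => 2 * A * N ^ 2 + (2 * A * N * C + C ^ 2) * (t - s)) s := by
      fun_prop
    have hev : ∀ᶠ t in 𝓝[>] s, 2 * A * N ^ 2 + (2 * A * N * C + C ^ 2) * (t - s) < r := by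
      refine (hcont.eventually_lt continuousAt_const ?_).filter_mono nhdsWithin_le_nhds
      simpa [hzd] using hr
    refine Eventually.frequently ?_
    filter_upwards [hev, Ioc_mem_nhdsGT hs.2] with t ht hts
    have hpos : 0 < t - s := sub_pos.2 hts.1
    refine lt_of_le_of_lt ?_ ht
    rw [inv_mul_le_iff₀ hpos, hzd]
    have h1 : infDist (y t) K ^ 2 ≤ ‖y t - z‖ ^ 2 := by
      have := infDist_le_dist_of_mem (x := y t) hz
      rw [dist_eq_norm] at this
      exact pow_le_pow_left₀ infDist_nonneg this 2
    have h2 : ‖y t - z‖ ^ 2 = N ^ 2 + 2 * inner ℝ (y s - z) (y t - y s) + ‖y t - y s‖ ^ 2 := by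
      rw [← norm_add_sq_real]
      congr 2
      abel
    have h3 := hin t hts
    have h4 : ‖y t - y s‖ ^ 2 ≤ (C * (t - s)) ^ 2 :=
      pow_le_pow_left₀ (norm_nonneg _) (hinc s hs t hts) 2
    nlinarith

lemma exists_closedBall_lipschitzOnWith {d m : ℕ} {Ω : Set (EV d)} (hΩ : IsOpen Ω)
    {Z : Fin m → EV d → EV d} (hZ : ∀ i, LocLipschitzOn (Z i) (closure Ω)) {x : EV d}
    (hx : x ∈ Ω) : ∃ R : ℝ, 0 < R ∧ closedBall x R ⊆ Ω ∧
      ∃ L : NNReal, ∀ i, LipschitzOnWith L (Z i) (closedBall x R) := by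
  choose K ε hε hL using fun i => hZ i x (subset_closure hx)
  have h1 : ∀ᶠ R in 𝓝[>] (0 : ℝ), ∀ i, R < ε i :=
    eventually_all.2 fun i => nhdsWithin_le_nhds (Iio_mem_nhds (hε i))
  obtain ⟨δ, hδ, hδΩ⟩ := Metric.isOpen_iff.1 hΩ x hx
  have h2 : ∀ᶠ R in 𝓝[>] (0 : ℝ), R < δ := nhdsWithin_le_nhds (Iio_mem_nhds hδ)
  obtain ⟨R, ⟨hR1, hR2⟩, hR0⟩ := ((h1.and h2).and self_mem_nhdsWithin).exists
  have hB : closedBall x R ⊆ Ω := (closedBall_subset_ball hR2).trans hδΩ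
  refine ⟨R, hR0, hB, ∑ i, K i, fun i => ?_⟩
  exact ((hL i).mono (subset_inter (hB.trans subset_closure)
    (closedBall_subset_ball (hR1 i)))).weaken
      (Finset.single_le_sum (fun _ _ => zero_le) (Finset.mem_univ i))

lemma continuousOn_of_locLipschitzOn {d m : ℕ} {Ω : Set (EV d)} (hΩ : IsOpen Ω)
    {Z : Fin m → EV d → EV d} (hZ : ∀ i, LocLipschitzOn (Z i) (closure Ω)) (i : Fin m) :
    ContinuousOn (Z i) Ω := by
  intro x hx
  obtain ⟨R, hR, -, L, hL⟩ := exists_closedBall_lipschitzOnWith hΩ hZ hx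
  exact ((hL i).continuousOn.continuousAt (closedBall_mem_nhds x hR)).continuousWithinAt

lemma Admissible.abs_le_one {m : ℕ} {β : ℝ → Fin m → ℝ} (hβ : Admissible β) (t : ℝ) (i : Fin m) :
    |β t i| ≤ 1 := by
  rw [← sq_le_one_iff_abs_le_one]
  exact (Finset.single_le_sum (f := fun j => β t j ^ 2) (fun j _ => sq_nonneg _)
    (Finset.mem_univ i)).trans (hβ.2 t)

lemma Admissible.norm_sum_smul_le {m : ℕ} {E : Type*} [NormedAddCommGroup E] [NormedSpace ℝ E]
    {β : ℝ → Fin m → ℝ} (hβ : Admissible β) (t : ℝ) (v : Fin m → E) :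
    ‖∑ i, β t i • v i‖ ≤ ∑ i, ‖v i‖ := by
  refine norm_sum_le_of_le _ fun i _ => ?_
  rw [norm_smul]
  exact mul_le_of_le_one_left (norm_nonneg _) (hβ.abs_le_one t i)

lemma Admissible.norm_inner_sum_smul_le {m : ℕ} {E : Type*} [NormedAddCommGroup E]
    [InnerProductSpace ℝ E] {β : ℝ → Fin m → ℝ} (hβ : Admissible β) (t : ℝ) {n : E}
    {v w : Fin m → E} {δ : ℝ} (hw : ∀ i, inner ℝ n (w i) = 0) (hvw : ∀ i, ‖v i - w i‖ ≤ δ) :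
    ‖inner ℝ n (∑ i, β t i • v i)‖ ≤ ‖n‖ * (m * δ) := by
  have h : inner ℝ n (∑ i, β t i • v i) = inner ℝ n (∑ i, β t i • (v i - w i)) := by
    simp [inner_sum, inner_smul_right, inner_sub_right, hw]
  rw [h]
  refine (norm_inner_le_norm _ _).trans (mul_le_mul_of_nonneg_left ?_ (norm_nonneg n))
  refine (hβ.norm_sum_smul_le t _).trans ?_
  simpa using Finset.sum_le_sum fun i (_ : i ∈ Finset.univ) => hvw i

lemma Admissible.integrableOn {d m : ℕ} {β : ℝ → Fin m → ℝ} (hβ : Admissible β) {T : ℝ}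
    {w : Fin m → ℝ → EV d} (hw : ∀ i, ContinuousOn (w i) (Icc 0 T)) :
    MeasureTheory.IntegrableOn (fun s => ∑ i, β s i • w i s) (Icc 0 T) := by
  refine MeasureTheory.integrable_finsetSum _ fun i _ => ?_
  exact (hw i).integrableOn_Icc.bdd_smul 1 (hβ.1 i).aestronglyMeasurable
    (.of_forall fun t => hβ.abs_le_one t i)

lemma IsTrajOn.sub_eq_integral {d m : ℕ} {Z : Fin m → EV d → EV d} {β : ℝ → Fin m → ℝ}
    {y : ℝ → EV d} {T : ℝ} (hy : IsTrajOn Z β y T)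
    (hint : MeasureTheory.IntegrableOn (fun s => ∑ i, β s i • Z i (y s)) (Icc 0 T))
    {s t : ℝ} (hs : s ∈ Icc 0 T) (ht : t ∈ Icc 0 T) :
    y t - y s = ∫ τ in s..t, ∑ i, β τ i • Z i (y τ) := by
  have hi : ∀ r ∈ Icc 0 T, IntervalIntegrable (fun s => ∑ i, β s i • Z i (y s))
      MeasureTheory.volume 0 r := fun r hr =>
    (intervalIntegrable_iff_integrableOn_Icc_of_le hr.1).2
      (hint.mono_set (Icc_subset_Icc_right hr.2))
  rw [hy.2 t ht, hy.2 s hs, add_sub_add_left_eq_sub,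
    intervalIntegral.integral_interval_sub_left (hi t ht) (hi s hs)]

lemma IsTrajOn.norm_sub_le {d m : ℕ} {Z : Fin m → EV d → EV d} {β : ℝ → Fin m → ℝ}
    {y : ℝ → EV d} {T : ℝ} (hy : IsTrajOn Z β y T)
    (hint : MeasureTheory.IntegrableOn (fun s => ∑ i, β s i • Z i (y s)) (Icc 0 T))
    {s t C : ℝ} (hs : s ∈ Icc 0 T) (ht : t ∈ Icc 0 T) (hst : s ≤ t)
    (hC : ∀ τ ∈ Icc s t, ‖∑ i, β τ i • Z i (y τ)‖ ≤ C) : ‖y t - y s‖ ≤ C * (t - s) := by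
  rw [hy.sub_eq_integral hint hs ht]
  have := intervalIntegral.norm_integral_le_of_norm_le_const (a := s) (b := t) (C := C)
    (f := fun τ => ∑ i, β τ i • Z i (y τ)) fun τ hτ => by
      rw [uIoc_of_le hst] at hτ
      exact hC τ (Ioc_subset_Icc_self hτ)
  rwa [abs_of_nonneg (sub_nonneg.2 hst)] at this

lemma IsTrajOn.inner_sub_le {d m : ℕ} {Z : Fin m → EV d → EV d} {β : ℝ → Fin m → ℝ}
    {y : ℝ → EV d} {T : ℝ} (hy : IsTrajOn Z β y T) (hβ : Admissible β)
    (hint : MeasureTheory.IntegrableOn (fun s => ∑ i, β s i • Z i (y s)) (Icc 0 T))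
    {s t δ : ℝ} (hs : s ∈ Icc 0 T) (ht : t ∈ Icc 0 T) (hst : s ≤ t) {n z : EV d}
    (horth : ∀ i, inner ℝ n (Z i z) = 0)
    (hδ : ∀ τ ∈ Icc s t, ∀ i, ‖Z i (y τ) - Z i z‖ ≤ δ) :
    inner ℝ n (y t - y s) ≤ ‖n‖ * (m * δ) * (t - s) := by
  have hii : IntervalIntegrable (fun τ => ∑ i, β τ i • Z i (y τ)) MeasureTheory.volume s t :=
    (intervalIntegrable_iff_integrableOn_Icc_of_le hst).2
      (hint.mono_set (Icc_subset_Icc hs.1 ht.2))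
  have hcomm := (innerSL ℝ n).intervalIntegral_comp_comm hii
  simp only [innerSL_apply_apply] at hcomm
  rw [hy.sub_eq_integral hint hs ht, ← hcomm]
  refine (le_abs_self _).trans ?_
  have hbound := intervalIntegral.norm_integral_le_of_norm_le_const (a := s) (b := t)
    (C := ‖n‖ * (m * δ)) (f := fun τ => inner ℝ n (∑ i, β τ i • Z i (y τ))) fun τ hτ => by
      rw [uIoc_of_le hst] at hτ
      exact hβ.norm_inner_sum_smul_le τ horth (hδ τ (Ioc_subset_Icc_self hτ))
  rwa [abs_of_nonneg (sub_nonneg.2 hst)] at hbound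

/-- If `z` is a nearest point to `w` in `K ∩ B` and `B` is a neighbourhood of `z`, then `w - z` is
a proximal normal to `K` at `z`. -/
lemma eventually_two_mul_inner_le_of_infDist_eq {E : Type*} [NormedAddCommGroup E]
    [InnerProductSpace ℝ E] {K B : Set E} {w z : E} (hB : B ∈ 𝓝 z)
    (hz : infDist w (K ∩ B) = dist w z) :
    ∀ᶠ x in 𝓝 z, x ∈ K → 2 * inner ℝ (w - z) (x - z) ≤ ‖x - z‖ ^ 2 := by
  filter_upwards [hB] with x hx hxK
  have h1 : infDist w (K ∩ B) ≤ dist w x := infDist_le_dist_of_mem ⟨hxK, hx⟩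
  rw [hz, dist_eq_norm, dist_eq_norm, ← sub_sub_sub_cancel_right w x z] at h1
  have h3 := pow_le_pow_left₀ (norm_nonneg (w - z)) h1 2
  rw [norm_sub_sq_real (w - z)] at h3
  linarith

/-- Local invariance of the set `K` under the control system, when the vector fields are
orthogonal to the proximal normals to `K`. -/
lemma IsTrajOn.exists_forall_mem {d m : ℕ} {Ω K : Set (EV d)} (hΩ : IsOpen Ω)
    (hKcpt : ∀ B ⊆ Ω, IsCompact B → IsCompact (K ∩ B))
    {Z : Fin m → EV d → EV d} (hZ : ∀ i, LocLipschitzOn (Z i) (closure Ω))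
    (horth : ∀ i, ∀ z ∈ K, ∀ n : EV d,
      (∀ᶠ x in 𝓝 z, x ∈ K → 2 * inner ℝ n (x - z) ≤ ‖x - z‖ ^ 2) → inner ℝ n (Z i z) = 0)
    {β : ℝ → Fin m → ℝ} (hβ : Admissible β) {y : ℝ → EV d} {T : ℝ} (hy : IsTrajOn Z β y T)
    (hyΩ : ∀ t ∈ Icc 0 T, y t ∈ Ω) {a : ℝ} (ha : a ∈ Ico 0 T) (haK : y a ∈ K) :
    ∃ b ∈ Ioc a T, ∀ t ∈ Icc a b, y t ∈ K := by
  have haT : a ∈ Icc 0 T := Ico_subset_Icc_self ha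
  obtain ⟨R, hR, hRΩ, L, hL⟩ := exists_closedBall_lipschitzOnWith hΩ hZ (hyΩ a haT)
  have hint : MeasureTheory.IntegrableOn (fun s => ∑ i, β s i • Z i (y s)) (Icc 0 T) :=
    hβ.integrableOn fun i => (continuousOn_of_locLipschitzOn hΩ hZ i).comp hy.1 hyΩ
  obtain ⟨b, hb, hbR⟩ : ∃ b ∈ Ioc a T, ∀ t ∈ Icc a b, dist (y t) (y a) < R / 4 := by
    have h1 : ∀ᶠ t in 𝓝[Icc 0 T] a, dist (y t) (y a) < R / 4 :=
      hy.1 a haT (ball_mem_nhds (y a) (by positivity))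
    have h2 : ∀ᶠ t in 𝓝[≥] a, dist (y t) (y a) < R / 4 :=
      h1.filter_mono (nhdsWithin_le_iff.2 (by
        filter_upwards [Icc_mem_nhdsGE ha.2] with t ht using ⟨ha.1.trans ht.1, ht.2⟩))
    obtain ⟨b, hb, hsub⟩ := (mem_nhdsGE_iff_exists_mem_Ioc_Ico_subset ha.2).1 h2
    refine ⟨(a + b) / 2, ⟨by linarith [hb.1], by linarith [hb.1, hb.2]⟩, fun t ht => hsub ⟨ht.1, ?_⟩⟩
    linarith [hb.1, ht.2]
  have hbT : ∀ t ∈ Icc a b, t ∈ Icc 0 T := fun t ht => ⟨ha.1.trans ht.1, ht.2.trans hb.2⟩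
  have hyB : ∀ t ∈ Icc a b, y t ∈ closedBall (y a) R := fun t ht => by
    rw [mem_closedBall]; linarith [hbR t ht]
  set C : ℝ := ∑ i, (‖Z i (y a)‖ + L * R) with hC
  have hCb : ∀ t ∈ Icc a b, ‖∑ i, β t i • Z i (y t)‖ ≤ C := fun t ht => by
    refine (hβ.norm_sum_smul_le t _).trans (Finset.sum_le_sum fun i _ => ?_)
    have h1 := (hL i).dist_le_mul _ (hyB t ht) _ (mem_closedBall_self hR.le)
    have h2 : (L : ℝ) * dist (y t) (y a) ≤ L * R := by
      gcongr
      exact hyB t ht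
    rw [dist_eq_norm] at h1
    have := norm_le_norm_add_norm_sub (Z i (y a)) (Z i (y t))
    rw [norm_sub_rev] at this
    linarith
  have hinc : ∀ s ∈ Icc a b, ∀ t ∈ Icc s b, ‖y t - y s‖ ≤ C * (t - s) := fun s hs t ht => by
    exact hy.norm_sub_le hint (hbT s hs) (hbT t ⟨hs.1.trans ht.1, ht.2⟩) ht.1
      fun τ hτ => hCb τ ⟨hs.1.trans hτ.1, hτ.2.trans ht.2⟩
  have hC0 : 0 ≤ C := (norm_nonneg _).trans (hCb a ⟨le_rfl, hb.1.le⟩)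
  set KR := K ∩ closedBall (y a) R
  have hKR : IsCompact KR := hKcpt _ hRΩ (isCompact_closedBall _ _)
  have haKR : y a ∈ KR := ⟨haK, mem_closedBall_self hR.le⟩
  refine ⟨b, hb, fun t ht => (mem_of_projection_estimate (A := m * L) (C := C) hKR.isClosed
    (hy.1.mono hbT) haKR (fun s hs t ht => hinc s ⟨hs.1, hs.2.le⟩ t ⟨ht.1.le, ht.2⟩)
    (fun s hs => ?_) t ht).1⟩
  have hs' : s ∈ Icc a b := ⟨hs.1, hs.2.le⟩
  obtain ⟨z, hz, hzd⟩ := hKR.exists_infDist_eq_dist ⟨_, haKR⟩ (y s)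
  refine ⟨z, hz, hzd, fun t ht => ?_⟩
  set n := y s - z with hn
  have hnR : ‖n‖ < R / 4 := by
    rw [hn, ← dist_eq_norm, ← hzd]
    exact (infDist_le_dist_of_mem haKR).trans_lt (hbR s hs')
  have hzb : ball (y a) R ∈ 𝓝 z := by
    refine isOpen_ball.mem_nhds ?_
    have h1 := hbR s hs'
    have h2 := dist_triangle_left z (y a) (y s)
    rw [dist_eq_norm (y s) z] at h2
    rw [mem_ball]
    linarith
  have hprox := eventually_two_mul_inner_le_of_infDist_eq
    (mem_of_superset hzb ball_subset_closedBall) hzd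
  have hst : Icc s t ⊆ Icc a b := Icc_subset_Icc hs.1 ht.2
  have hbound := hy.inner_sub_le hβ hint (hbT s hs') (hbT t (hst ⟨ht.1.le, le_rfl⟩)) ht.1.le
    (δ := L * (‖n‖ + C * (t - s))) (fun i => horth i z hz.1 n hprox) fun τ hτ i => by
      have h2 : ‖y τ - z‖ ≤ ‖n‖ + C * (t - s) := by
        have h3 := hinc s hs' τ ⟨hτ.1, hτ.2.trans ht.2⟩
        have h4 : C * (τ - s) ≤ C * (t - s) :=
          mul_le_mul_of_nonneg_left (sub_le_sub_right hτ.2 s) hC0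
        have h5 : y τ - z = n + (y τ - y s) := by rw [hn]; abel
        rw [h5]
        linarith [norm_add_le n (y τ - y s)]
      rw [← dist_eq_norm]
      refine ((hL i).dist_le_mul _ (hyB τ (hst hτ)) _ hz.2).trans ?_
      rw [dist_eq_norm]
      exact mul_le_mul_of_nonneg_left h2 L.2
  exact hbound.trans_eq (by ring)

/-- Theorem 2.5: the propagation set of a nonnegative interior maximum of a
viscosity subsolution contains all points reachable from it by the control system driven by
locally Lipschitz subunit vector fields of `F`. -/
theorem propagation_contains_reachable_set {d m : ℕ} (Ω : Set (EV d))
    (hΩ : IsOpen Ω) (hconn : IsConnected Ω)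
    (F : EV d → ℝ → EV d → Matrix (Fin d) (Fin d) ℝ → ℝ)
    (hFlsc : IsLscOperator Ω F) (hFprop : IsProper Ω F) (hFscal : HasScaling Ω F)
    (Z : Fin m → EV d → EV d) (hZlip : ∀ i, LocLipschitzOn (Z i) (closure Ω))
    (hZsv : ∀ i, ∀ x ∈ Ω, IsSubunitAt F x (Z i x))
    (u : EV d → ℝ) (husc : UpperSemicontinuousOn u Ω)
    (hsub : IsViscSubsol Ω F u)
    (x₀ : EV d) (hx₀ : x₀ ∈ Ω) (hmax : ∀ x ∈ Ω, u x ≤ u x₀) (hnn : 0 ≤ u x₀) :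
    ∀ x₁ : EV d,
      (∃ (β : ℝ → Fin m → ℝ) (y : ℝ → EV d) (T : ℝ), 0 < T ∧ Admissible β ∧
        IsTrajOn Z β y T ∧ (∀ t ∈ Icc 0 T, y t ∈ Ω) ∧ y 0 = x₀ ∧ y T = x₁) →
      u x₁ = u x₀ := by
  rintro x₁ ⟨β, y, T, hT, hβ, hy, hyΩ, rfl, rfl⟩
  set M := u (y 0)
  set K : Set (EV d) := {x | x ∈ Ω ∧ u x = M}
  have hKeq : ∀ B ⊆ Ω, K ∩ B = B ∩ u ⁻¹' Ici M := fun B hB => by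
    ext x
    exact ⟨fun h => ⟨h.2, h.1.2.ge⟩, fun h => ⟨⟨hB h.1, (hmax x (hB h.1)).antisymm h.2⟩, h.1⟩⟩
  have hKcpt : ∀ B ⊆ Ω, IsCompact B → IsCompact (K ∩ B) := fun B hB hBc => by
    rw [hKeq B hB]
    exact (husc.mono hB).isCompact_inter_preimage_Ici hBc M
  have horth : ∀ i, ∀ z ∈ K, ∀ n : EV d,
      (∀ᶠ x in 𝓝 z, x ∈ K → 2 * inner ℝ n (x - z) ≤ ‖x - z‖ ^ 2) → inner ℝ n (Z i z) = 0 :=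
    fun i z hz n hn => inner_eq_zero_of_proximal_normal hΩ hFlsc hFprop hFscal husc hsub hnn hmax
      hz.1 hz.2 (hZsv i z hz.1) (hn.mono fun x hx h1 h2 => hx ⟨h1, h2⟩)
  have hclosed : IsClosed (y ⁻¹' K ∩ Icc 0 T) := by
    have hc : IsCompact (K ∩ y '' Icc 0 T) :=
      hKcpt _ (image_subset_iff.2 hyΩ) (isCompact_Icc.image_of_continuousOn hy.1)
    have : y ⁻¹' K ∩ Icc 0 T = Icc 0 T ∩ y ⁻¹' (K ∩ y '' Icc 0 T) := by
      ext t
      exact ⟨fun h => ⟨h.2, h.1, mem_image_of_mem y h.2⟩, fun h => ⟨h.2.1, h.1⟩⟩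
    rw [this]
    exact hy.1.preimage_isClosed_of_isClosed isClosed_Icc hc.isClosed
  have hsubset : Icc 0 T ⊆ y ⁻¹' K := by
    refine hclosed.Icc_subset_of_forall_exists_gt ⟨hx₀, rfl⟩ fun a ha c hc => ?_
    obtain ⟨b, hb, hbK⟩ := hy.exists_forall_mem hΩ hKcpt hZlip horth hβ hyΩ ha.2 ha.1
    have hab : a < min b c := lt_min hb.1 hc
    exact ⟨min b c, hbK _ ⟨hab.le, min_le_left _ _⟩, hab, min_le_right _ _⟩
  exact (hsubset ⟨hT.le, le_rfl⟩).2
end
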